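/- Let p be a prime and let d ≥ 2 be even. The rank over the field with p elements of the oppositeness matrix of generators of the Hermitian polar space H(2d-1, p^2) is at most p^{2d-1} - p·(p^{2d-2} - 1)/(p + 1). -/

import Mathlib

section HermitianNorm

variable {p : ℕ} {F : Type*} [Field F] [Fintype F]

theorem card_units_of_card_eq_sq (hF : Fintype.card F = p ^ 2) :
    Nat.card Fˣ = (p + 1) * (p - 1) := by
  rw [Nat.card_units, Nat.card_eq_fintype_card, hF]
  simpa using Nat.sq_sub_sq p 1

theorem pow_char_pow_char (hF : Fintype.card F = p ^ 2) (x : F) : (x ^ p) ^ p = x := by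
  rw [← pow_mul, ← sq, ← hF, FiniteField.pow_card]

theorem card_ker_normPow (hF : Fintype.card F = p ^ 2) :
    Nat.card (powMonoidHom (p + 1) : Fˣ →* Fˣ).ker = p + 1 := by
  rw [IsCyclic.card_powMonoidHom_ker, card_units_of_card_eq_sq hF, Nat.gcd_mul_right_left]

theorem range_normPow (hF : Fintype.card F = p ^ 2) :
    (powMonoidHom (p + 1) : Fˣ →* Fˣ).range = (powMonoidHom (p - 1) : Fˣ →* Fˣ).ker := by
  refine Subgroup.eq_of_le_of_card_ge ?_ ?_
  · rintro _ ⟨x, rfl⟩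
    rw [MonoidHom.mem_ker, powMonoidHom_apply, powMonoidHom_apply, ← pow_mul,
      ← card_units_of_card_eq_sq hF, pow_card_eq_one']
  · rw [IsCyclic.card_powMonoidHom_ker, IsCyclic.card_powMonoidHom_range,
      card_units_of_card_eq_sq hF, Nat.gcd_mul_right_left, Nat.gcd_mul_left_left,
      Nat.mul_div_cancel_left _ (Nat.succ_pos p)]

variable [Fact p.Prime]

theorem card_normPow_fiber (hF : Fintype.card F = p ^ 2) [DecidableEq F] {s : Fˣ}
    (hs : s ^ p = s) : (Finset.univ.filter fun l : Fˣ => l ^ (p + 1) = s).card = p + 1 := by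
  have hp1 : p - 1 + 1 = p := Nat.sub_add_cancel (Fact.out : p.Prime).one_le
  have hmem : s ∈ (powMonoidHom (p + 1) : Fˣ →* Fˣ).range := by
    rw [range_normPow hF, MonoidHom.mem_ker, powMonoidHom_apply]
    have : s ^ (p - 1) * s = 1 * s := by rw [← pow_succ, hp1, hs, one_mul]
    exact mul_right_cancel this
  have h := MonoidHom.card_fiber_eq_of_mem_range (powMonoidHom (p + 1) : Fˣ →* Fˣ)
    (x := s) (y := 1) hmem ⟨1, by simp⟩
  simp only [powMonoidHom_apply] at h
  have hker := card_ker_normPow hF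
  rw [Nat.card_eq_fintype_card, Fintype.card_subtype] at hker
  simpa [h, MonoidHom.mem_ker] using hker

theorem exists_addChar_sub_pow_ne_one (hF : Fintype.card F = p ^ 2) :
    ∃ ψ : AddChar F ℂ, ∃ x : F, ψ (x - x ^ p) ≠ 1 := by
  have hp : p.Prime := Fact.out
  obtain ⟨x, hx⟩ : ∃ x : F, x ^ p ≠ x := by
    by_contra! h
    have h1 : Fintype.card F ≤ p := by
      have := Polynomial.card_roots' (Polynomial.X ^ p - Polynomial.X : Polynomial F)
      rw [FiniteField.X_pow_card_sub_X_natDegree_eq F hp.one_lt] at this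
      refine le_trans ?_ this
      rw [← Finset.card_univ]
      refine Multiset.card_le_card ((Multiset.le_iff_subset Finset.univ.nodup).2 fun y _ => ?_)
      rw [Polynomial.mem_roots (FiniteField.X_pow_card_sub_X_ne_zero F hp.one_lt)]
      simp [h y]
    rw [hF] at h1
    nlinarith [hp.two_le]
  obtain ⟨ψ, hψ⟩ := AddChar.exists_apply_ne_zero.2 (sub_ne_zero.2 hx.symm)
  exact ⟨ψ, x, hψ⟩

theorem sum_addChar_normPow_mul [DecidableEq F] [CharP F p] (hF : Fintype.card F = p ^ 2)
    {ψ : AddChar F ℂ} {x₀ : F} (hψ : ψ (x₀ - x₀ ^ p) ≠ 1) {t : F} (ht : t ^ p = -t) (ht0 : t ≠ 0) :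
    ∑ l : Fˣ, ψ ((l : F) ^ (p + 1) * t) = -(p + 1) := by
  have hp : p.Prime := Fact.out
  let T : Finset F := Finset.univ.filter fun u => u ^ p = -u
  have hT : ∑ u ∈ T, ψ u = 0 := by
    have h : ∑ u ∈ T, ψ u = ∑ u ∈ T, ψ (u + (x₀ - x₀ ^ p)) := by
      refine Finset.sum_nbij' (fun u => u - (x₀ - x₀ ^ p)) (fun u => u + (x₀ - x₀ ^ p))
        ?_ ?_ ?_ ?_ ?_
      · simp only [T, Finset.mem_filter, Finset.mem_univ, true_and]
        intro u hu
        rw [sub_pow_char, sub_pow_char, pow_char_pow_char hF, hu]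
        ring
      · simp only [T, Finset.mem_filter, Finset.mem_univ, true_and]
        intro u hu
        rw [add_pow_char, sub_pow_char, pow_char_pow_char hF, hu]
        ring
      all_goals simp
    simp only [AddChar.map_add_eq_mul, ← Finset.sum_mul] at h
    have h2 : (∑ u ∈ T, ψ u) * (ψ (x₀ - x₀ ^ p) - 1) = 0 := by
      rw [mul_sub, ← h, mul_one, sub_self]
    exact (mul_eq_zero.1 h2).resolve_right (sub_ne_zero.2 hψ)
  have hl : ∀ l : Fˣ, ((l : F) ^ (p + 1)) ^ p = (l : F) ^ (p + 1) := fun l => by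
    rw [pow_succ, mul_pow, pow_char_pow_char hF, mul_comm]
  have hmaps : ∀ l ∈ (Finset.univ : Finset Fˣ), (l : F) ^ (p + 1) * t ∈ T.erase 0 := by
    intro l _
    simp only [T, Finset.mem_erase, Finset.mem_filter, Finset.mem_univ, true_and]
    refine ⟨mul_ne_zero (pow_ne_zero _ l.ne_zero) ht0, ?_⟩
    rw [mul_pow, hl, ht, mul_neg]
  rw [← Finset.sum_fiberwise_of_maps_to hmaps]
  have hfib : ∀ u ∈ T.erase 0,
      ∑ l ∈ Finset.univ.filter fun l : Fˣ => (l : F) ^ (p + 1) * t = u,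
        ψ ((l : F) ^ (p + 1) * t) = (p + 1) * ψ u := by
    intro u hu
    simp only [T, Finset.mem_erase, Finset.mem_filter, Finset.mem_univ, true_and] at hu
    rw [Finset.sum_congr rfl (g := fun _ => ψ u) (fun l h => by rw [(Finset.mem_filter.1 h).2]),
      Finset.sum_const, nsmul_eq_mul]
    let s : Fˣ := Units.mk0 (u / t) (div_ne_zero hu.1 ht0)
    have hs : s ^ p = s := by
      ext
      simp [s, div_pow, hu.2, ht]
    have hcard := card_normPow_fiber hF hs
    have : (Finset.univ.filter fun l : Fˣ => (l : F) ^ (p + 1) * t = u) =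
        Finset.univ.filter fun l : Fˣ => l ^ (p + 1) = s := by
      ext l
      simp [s, Units.ext_iff, eq_div_iff ht0]
    rw [this, hcard]
    push_cast
    ring
  rw [Finset.sum_congr rfl hfib, ← Finset.mul_sum]
  have h0 : (0 : F) ∈ T := by simp [T, hp.ne_zero]
  rw [← Finset.add_sum_erase T _ h0, AddChar.map_zero_eq_one] at hT
  linear_combination ((p : ℂ) + 1) * hT

end HermitianNorm

section GaussSum

variable {p : ℕ} {F : Type*} [Field F]
variable {K : Type*} [AddCommGroup K] [Module F K] {B : K → K → F}

theorem card_units_dvd_card_of_zero_notMem (s : SubMulAction Fˣ K) (hs : (0 : K) ∉ s) :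
    Nat.card Fˣ ∣ Nat.card s := by
  have hstab : ∀ b : s, MulAction.stabilizer Fˣ b = ⊥ := by
    intro b
    refine (Subgroup.eq_bot_iff_forall _).2 fun l hl => ?_
    have hb : (b : K) ≠ 0 := fun h => hs (h ▸ b.2)
    have h1 : (l : F) • (b : K) = (1 : F) • (b : K) := by
      rw [one_smul]
      exact congrArg Subtype.val (MulAction.mem_stabilizer_iff.1 hl)
    exact Units.ext (smul_left_injective F hb h1)
  rw [Nat.card_congr (MulAction.selfEquivOrbitsQuotientProd hstab), Nat.card_prod]
  exact Dvd.intro_left _ rfl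

theorem sesq_smul_smul (hsmul : ∀ (l : F) x y, B (l • x) y = l * B x y)
    (hskew : ∀ x y, B y x = -(B x y) ^ p) (l : F) (x y : K) :
    B (l • x) (l • y) = l ^ (p + 1) * B x y := by
  have h : ∀ u v, B u (l • v) = l ^ p * B u v := by
    intro u v
    rw [hskew (l • v) u, hsmul, mul_pow, hskew v u]
    ring
  rw [hsmul, h]
  ring

variable [Fact p.Prime] [Fintype F] [Fintype K]

theorem card_units_mul_sum_addChar_sesq [CharP F p] [DecidableEq F] (hF : Fintype.card F = p ^ 2)
    {ψ : AddChar F ℂ} {x₀ : F} (hψ : ψ (x₀ - x₀ ^ p) ≠ 1)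
    (hsmul : ∀ (l : F) x y, B (l • x) y = l * B x y)
    (hskew : ∀ x y, B y x = -(B x y) ^ p) :
    (Nat.card Fˣ : ℂ) * ∑ x, ψ (B x x) =
      Nat.card Fˣ * (Finset.univ.filter fun x => B x x = 0).card -
        (p + 1) * (Finset.univ.filter fun x => B x x ≠ 0).card := by
  have h1 : ∀ l : Fˣ, ∑ x, ψ (B x x) = ∑ x, ψ ((l : F) ^ (p + 1) * B x x) := by
    intro l
    rw [← Equiv.sum_comp (MulAction.toPerm l : Equiv.Perm K)]
    refine Finset.sum_congr rfl fun x _ => ?_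
    rw [← sesq_smul_smul hsmul hskew]
    rfl
  have h2 : (Nat.card Fˣ : ℂ) * ∑ x, ψ (B x x) =
      ∑ x, ∑ l : Fˣ, ψ ((l : F) ^ (p + 1) * B x x) := by
    rw [Finset.sum_comm, ← Finset.sum_congr rfl fun l _ => h1 l, Finset.sum_const, nsmul_eq_mul,
      Finset.card_univ, Nat.card_eq_fintype_card]
  have h3 : ∀ x, ∑ l : Fˣ, ψ ((l : F) ^ (p + 1) * B x x) =
      if B x x = 0 then (Nat.card Fˣ : ℂ) else -(p + 1) := by
    intro x
    split_ifs with hx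
    · simp [hx, Nat.card_eq_fintype_card]
    · refine sum_addChar_normPow_mul hF hψ ?_ hx
      conv_rhs => rw [hskew x x]
      rw [neg_neg]
  rw [h2, Finset.sum_congr rfl fun x _ => h3 x, Finset.sum_ite, Finset.sum_const, Finset.sum_const]
  simp only [nsmul_eq_mul]
  ring

theorem exists_sum_addChar_sesq_eq [CharP F p] [DecidableEq F] (hF : Fintype.card F = p ^ 2)
    {ψ : AddChar F ℂ} {x₀ : F} (hψ : ψ (x₀ - x₀ ^ p) ≠ 1)
    (hsmul : ∀ (l : F) x y, B (l • x) y = l * B x y)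
    (hskew : ∀ x y, B y x = -(B x y) ^ p) :
    ∃ m : ℤ, ∑ x, ψ (B x x) = ((1 + (p + 1) * m : ℤ) : ℂ) := by
  classical
  have hp : p.Prime := Fact.out
  have h := card_units_mul_sum_addChar_sesq hF hψ hsmul hskew
  have hunits : ∀ (l : Fˣ) x, B (l • x) (l • x) = (l : F) ^ (p + 1) * B x x := fun l x =>
    sesq_smul_smul hsmul hskew _ _ _
  have h00 : B 0 0 = 0 := by simpa using hsmul 0 0 0
  let I : SubMulAction Fˣ K :=
    { carrier := {x | x ≠ 0 ∧ B x x = 0}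
      smul_mem' := fun l x hx => ⟨(smul_ne_zero_iff_ne l).2 hx.1, by rw [hunits, hx.2, mul_zero]⟩ }
  let J : SubMulAction Fˣ K :=
    { carrier := {x | B x x ≠ 0}
      smul_mem' := fun l x hx => by
        rw [Set.mem_ofPred_eq, hunits]
        exact mul_ne_zero (pow_ne_zero _ l.ne_zero) hx }
  obtain ⟨i, hi⟩ := card_units_dvd_card_of_zero_notMem I fun h => h.1 rfl
  obtain ⟨j, hj⟩ := card_units_dvd_card_of_zero_notMem J fun h => h h00
  have hI : (Finset.univ.filter fun x => B x x = 0).card = Nat.card Fˣ * i + 1 := by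
    have hI' : Nat.card I = ((Finset.univ.filter fun x => B x x = 0).erase 0).card := by
      rw [Nat.card_eq_fintype_card]
      refine Fintype.card_of_subtype _ fun x => ?_
      simp only [Finset.mem_erase, Finset.mem_filter, Finset.mem_univ, true_and]
      rfl
    rw [← hi, hI', Finset.card_erase_add_one]
    simp [h00]
  have hJ : (Finset.univ.filter fun x => B x x ≠ 0).card = Nat.card Fˣ * j := by
    rw [← hj, Nat.card_eq_fintype_card]
    refine (Fintype.card_of_subtype _ fun x => ?_).symm
    simp only [Finset.mem_filter, Finset.mem_univ, true_and]
    rfl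
  have hpos : (Nat.card Fˣ : ℂ) ≠ 0 := Nat.cast_ne_zero.2 Nat.card_pos.ne'
  refine ⟨(p - 1) * i - j, mul_left_cancel₀ hpos ?_⟩
  rw [h, hI, hJ]
  have hc : (Nat.card Fˣ : ℂ) = (p + 1) * (p - 1) := by
    rw [card_units_of_card_eq_sq hF, Nat.cast_mul, Nat.cast_sub hp.one_le]
    push_cast
    ring
  push_cast
  rw [hc]
  ring

theorem sum_addChar_sesq_mul_inv [CharP F p] (hF : Fintype.card F = p ^ 2)
    {ψ : AddChar F ℂ} {x₀ : F} (hψ : ψ (x₀ - x₀ ^ p) ≠ 1)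
    (hadd : ∀ x y z, B (x + y) z = B x z + B y z)
    (hsmul : ∀ (l : F) x y, B (l • x) y = l * B x y)
    (hskew : ∀ x y, B y x = -(B x y) ^ p)
    (R : Submodule F K) (hR : ∀ z, z ∈ R ↔ ∀ y, B z y = 0) :
    (∑ x, ψ (B x x)) * ∑ x, ψ⁻¹ (B x x) = Nat.card K * Nat.card R := by
  classical
  have hadd' : ∀ x y z, B x (y + z) = B x y + B x z := by
    intro x y z
    rw [hskew (y + z) x, hadd, add_pow_char, hskew y x, hskew z x]
    ring
  have h1 : (∑ x, ψ (B x x)) * ∑ x, ψ⁻¹ (B x x) =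
      ∑ z, ψ (B z z) * ∑ y, ψ (B z y - B z y ^ p) := by
    rw [Finset.sum_mul_sum, Finset.sum_comm]
    have : ∀ y, ∑ x, ψ (B x x) * ψ⁻¹ (B y y) = ∑ z, ψ (B z z) * ψ (B z y - B z y ^ p) := by
      intro y
      rw [← Equiv.sum_comp (Equiv.addRight y)]
      refine Finset.sum_congr rfl fun z _ => ?_
      rw [AddChar.inv_apply, ← AddChar.map_add_eq_mul, ← AddChar.map_add_eq_mul]
      congr 1
      simp only [Equiv.coe_addRight, hadd, hadd']
      rw [hskew z y]
      ring
    rw [Finset.sum_congr rfl fun y _ => this y, Finset.sum_comm]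
    simp only [Finset.mul_sum]
  have h2 : ∀ z, ψ (B z z) * ∑ y, ψ (B z y - B z y ^ p) =
      if z ∈ R then (Nat.card K : ℂ) else 0 := by
    intro z
    split_ifs with hz
    · have hz' := (hR z).1 hz
      simp [hz', (Fact.out : p.Prime).ne_zero, Nat.card_eq_fintype_card]
    · let χ : AddChar K ℂ :=
        { toFun := fun y => ψ (B z y - B z y ^ p)
          map_zero_eq_one' := by
            have : B z 0 = 0 := by simpa using hadd' z 0 0
            simp [this, (Fact.out : p.Prime).ne_zero]
          map_add_eq_mul' := fun x y => by
            rw [← AddChar.map_add_eq_mul, hadd', add_pow_char]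
            congr 1
            ring }
      have hχ : χ ≠ 1 := by
        rw [hR] at hz
        push Not at hz
        obtain ⟨y, hy⟩ := hz
        intro h
        refine hψ ?_
        have h3 : B z (((x₀ / B z y) ^ p) • y) = x₀ := by
          rw [hskew _ z, hsmul, mul_pow, pow_char_pow_char hF, hskew z y]
          have : ((-1 : F) ^ p) = -1 := by
            exact neg_one_pow_char F p
          rw [neg_pow, this, pow_char_pow_char hF]
          field_simp
        have h4 := DFunLike.congr_fun h (((x₀ / B z y) ^ p) • y)
        change ψ (B z _ - B z _ ^ p) = 1 at h4
        rwa [h3] at h4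
      have := AddChar.sum_eq_zero_of_ne_one hχ
      change ∑ y, ψ (B z y - B z y ^ p) = 0 at this
      rw [this, mul_zero]
  rw [h1, Finset.sum_congr rfl fun z _ => h2 z, Finset.sum_ite, Finset.sum_const_zero, add_zero,
    Finset.sum_const, nsmul_eq_mul, mul_comm, Nat.card_eq_fintype_card (α := R),
    Fintype.card_subtype]

/-- The Gauss sum of a possibly degenerate skew-Hermitian form over `GF(p²)`. -/
theorem sum_addChar_sesq [CharP F p] (hF : Fintype.card F = p ^ 2)
    {ψ : AddChar F ℂ} {x₀ : F} (hψ : ψ (x₀ - x₀ ^ p) ≠ 1)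
    (hadd : ∀ x y z, B (x + y) z = B x z + B y z)
    (hsmul : ∀ (l : F) x y, B (l • x) y = l * B x y)
    (hskew : ∀ x y, B y x = -(B x y) ^ p)
    (R : Submodule F K) (hR : ∀ z, z ∈ R ↔ ∀ y, B z y = 0) :
    ∑ x, ψ (B x x) = (-p : ℂ) ^ (Module.finrank F K + Module.finrank F R) := by
  classical
  have hp : p.Prime := Fact.out
  have hψ' : ψ⁻¹ (x₀ - x₀ ^ p) ≠ 1 := by
    rw [AddChar.inv_apply']
    exact fun h => hψ (inv_eq_one.1 h)
  have hinv : ∑ x, ψ⁻¹ (B x x) = ∑ x, ψ (B x x) := by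
    have hpos : (Nat.card Fˣ : ℂ) ≠ 0 := Nat.cast_ne_zero.2 Nat.card_pos.ne'
    refine mul_left_cancel₀ hpos ?_
    rw [card_units_mul_sum_addChar_sesq hF hψ hsmul hskew,
      card_units_mul_sum_addChar_sesq hF hψ' hsmul hskew]
  have hmul := sum_addChar_sesq_mul_inv hF hψ hadd hsmul hskew R hR
  obtain ⟨m, hm⟩ := exists_sum_addChar_sesq_eq hF hψ hsmul hskew
  rw [hinv, hm, Nat.card_eq_fintype_card, Nat.card_eq_fintype_card,
    Module.card_eq_pow_finrank (K := F) (V := K), Module.card_eq_pow_finrank (K := F) (V := R),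
    hF] at hmul
  set e := Module.finrank F K + Module.finrank F R with he
  have hsq : (1 + (p + 1) * m : ℤ) ^ 2 = ((-p : ℤ) ^ e) ^ 2 := by
    have : ((-p : ℤ) ^ e) ^ 2 =
        (p ^ 2 : ℤ) ^ Module.finrank F K * (p ^ 2 : ℤ) ^ Module.finrank F R := by
      rw [← pow_add, ← he, ← pow_mul, mul_comm, pow_mul, neg_sq]
    rw [this, sq]
    exact_mod_cast hmul
  have hmod : ((p : ℤ) + 1) ∣ (-p) ^ e - 1 := by
    have := sub_one_dvd_pow_sub_one (-p : ℤ) e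
    refine dvd_trans ⟨-1, by ring⟩ this
  rw [hm]
  rcases sq_eq_sq_iff_eq_or_eq_neg.1 hsq with h | h
  · rw [h]
    push_cast
    ring
  · exfalso
    have h2 : ((p : ℤ) + 1) ∣ 2 := by
      have h3 : (2 : ℤ) = -((-p : ℤ) ^ e - 1) - (p + 1) * m := by linear_combination h
      rw [h3]
      exact dvd_sub (hmod.neg_right) (dvd_mul_right _ _)
    have := Int.le_of_dvd (by norm_num) h2
    have := hp.two_le
    omega

end GaussSum

section HermitianForm

theorem sum_addChar_eq_zero_of_surjective {M : Type*} [AddCommGroup M] [Fintype M]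
    {A : Type*} [AddCommGroup A] {ψ : AddChar A ℂ} (hψ : ψ ≠ 1) {f : M → A}
    (hadd : ∀ x y, f (x + y) = f x + f y) (hf : Function.Surjective f) : ∑ x, ψ (f x) = 0 := by
  have h : ψ.compAddMonoidHom (AddMonoidHom.mk' f hadd) ≠ 1 := by
    intro h
    refine hψ (DFunLike.ext _ _ fun t => ?_)
    obtain ⟨x, rfl⟩ := hf t
    exact DFunLike.congr_fun h x
  exact AddChar.sum_eq_zero_of_ne_one h

variable {p : ℕ} {F : Type*} [Field F] {ι : Type*} [Fintype ι]

/-- The standard Hermitian form `∑ i, x i * y i ^ p` on `ι → F`. -/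
def hermForm (p : ℕ) (x y : ι → F) : F := ∑ i, x i * y i ^ p

theorem hermForm_add_left (x y z : ι → F) :
    hermForm p (x + y) z = hermForm p x z + hermForm p y z := by
  simp [hermForm, add_mul, Finset.sum_add_distrib]

theorem hermForm_smul_left (l : F) (x y : ι → F) :
    hermForm p (l • x) y = l * hermForm p x y := by
  simp [hermForm, Finset.mul_sum, mul_assoc]

theorem hermForm_zero_left (y : ι → F) : hermForm p 0 y = 0 := by
  simp [hermForm]

theorem hermForm_neg_left (x y : ι → F) : hermForm p (-x) y = -hermForm p x y := by
  simp [hermForm]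

theorem hermForm_smul_right (l : F) (x y : ι → F) :
    hermForm p x (l • y) = l ^ p * hermForm p x y := by
  simp only [hermForm, Finset.mul_sum, Pi.smul_apply, smul_eq_mul, mul_pow]
  exact Finset.sum_congr rfl fun i _ => by ring

/-- The orthogonal complement with respect to `hermForm`. -/
def hermPerp (p : ℕ) (W : Submodule F (ι → F)) : Submodule F (ι → F) where
  carrier := {y | ∀ x ∈ W, hermForm p y x = 0}
  add_mem' := fun {u v} hu hv x hx => by rw [hermForm_add_left, hu x hx, hv x hx, add_zero]
  zero_mem' := fun x _ => hermForm_zero_left x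
  smul_mem' := fun l u hu x hx => by rw [hermForm_smul_left, hu x hx, mul_zero]

theorem mem_hermPerp {W : Submodule F (ι → F)} {y : ι → F} :
    y ∈ hermPerp p W ↔ ∀ x ∈ W, hermForm p y x = 0 := Iff.rfl

variable [Fact p.Prime] [CharP F p]

theorem hermForm_add_right (x y z : ι → F) :
    hermForm p x (y + z) = hermForm p x y + hermForm p x z := by
  simp [hermForm, add_pow_char, mul_add, Finset.sum_add_distrib]

theorem hermForm_neg_right (x y : ι → F) : hermForm p x (-y) = -hermForm p x y := by
  rw [eq_neg_iff_add_eq_zero, ← hermForm_add_right, neg_add_cancel]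
  simp [hermForm, (Fact.out : p.Prime).ne_zero]

theorem hermForm_sub_right (x y z : ι → F) :
    hermForm p x (y - z) = hermForm p x y - hermForm p x z := by
  rw [sub_eq_add_neg, hermForm_add_right, hermForm_neg_right, sub_eq_add_neg]

theorem hermPerp_sup (A B : Submodule F (ι → F)) :
    hermPerp p (A ⊔ B) = hermPerp p A ⊓ hermPerp p B := by
  ext y
  simp only [Submodule.mem_inf, mem_hermPerp]
  refine ⟨fun h => ⟨fun x hx => h x (Submodule.mem_sup_left hx),
    fun x hx => h x (Submodule.mem_sup_right hx)⟩, fun h x hx => ?_⟩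
  obtain ⟨u, hu, v, hv, rfl⟩ := Submodule.mem_sup.1 hx
  rw [hermForm_add_right, h.1 u hu, h.2 v hv, add_zero]

variable [Fintype F]

theorem hermForm_symm (hF : Fintype.card F = p ^ 2) (x y : ι → F) :
    hermForm p y x = hermForm p x y ^ p := by
  simp only [hermForm]
  rw [sum_pow_char]
  refine Finset.sum_congr rfl fun i _ => ?_
  rw [mul_pow, pow_char_pow_char hF, mul_comm]

theorem card_mul_card_hermPerp (hF : Fintype.card F = p ^ 2) (W : Submodule F (ι → F)) :
    Nat.card W * Nat.card (hermPerp p W) = Nat.card (ι → F) := by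
  classical
  have hp : p.Prime := Fact.out
  obtain ⟨ψ, x₀, hx₀⟩ := exists_addChar_sub_pow_ne_one hF
  have hψ : ψ ≠ 1 := fun h => hx₀ (by rw [h]; rfl)
  have h1 : ∀ y : ι → F, ∑ x : W, ψ (hermForm p y x) =
      if y ∈ hermPerp p W then (Nat.card W : ℂ) else 0 := by
    intro y
    split_ifs with hy
    · rw [mem_hermPerp] at hy
      rw [Finset.sum_congr rfl fun x _ => by rw [hy x x.2, AddChar.map_zero_eq_one]]
      simp [Nat.card_eq_fintype_card]
    · rw [mem_hermPerp] at hy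
      push Not at hy
      obtain ⟨x, hx, hxy⟩ := hy
      refine sum_addChar_eq_zero_of_surjective hψ
        (fun u v => hermForm_add_right _ _ _) fun t => ?_
      refine ⟨((t / hermForm p y x) ^ p) • ⟨x, hx⟩, ?_⟩
      rw [Submodule.coe_smul, hermForm_smul_right, pow_char_pow_char hF, div_mul_cancel₀ _ hxy]
  have h2 : ∀ x : W, ∑ y : ι → F, ψ (hermForm p y x) =
      if x = 0 then (Nat.card (ι → F) : ℂ) else 0 := by
    intro x
    split_ifs with hx
    · have : ∀ y : ι → F, hermForm p y ((0 : W) : ι → F) = 0 := fun y => by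
        simp [hermForm, hp.ne_zero]
      simp only [hx, this, AddChar.map_zero_eq_one]
      simp [Nat.card_eq_fintype_card]
    · obtain ⟨i, hi⟩ : ∃ i, (x : ι → F) i ≠ 0 := by
        by_contra! h
        exact hx (Subtype.ext (funext h))
      refine sum_addChar_eq_zero_of_surjective hψ
        (fun u v => hermForm_add_left _ _ _) fun t => ?_
      refine ⟨Pi.single i (t / (x : ι → F) i ^ p), ?_⟩
      rw [hermForm, Finset.sum_eq_single i]
      · rw [Pi.single_eq_same, div_mul_cancel₀ _ (pow_ne_zero _ hi)]
      · intro j _ hj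
        rw [Pi.single_eq_of_ne hj, zero_mul]
      · simp
  have h3 : ∑ y : ι → F, ∑ x : W, ψ (hermForm p y x) =
      ∑ x : W, ∑ y : ι → F, ψ (hermForm p y x) := Finset.sum_comm
  simp only [h1, h2, Finset.sum_ite_eq', Finset.mem_univ, if_true] at h3
  rw [Finset.sum_ite, Finset.sum_const, Finset.sum_const_zero, add_zero, nsmul_eq_mul,
    ← Fintype.card_subtype, ← Nat.card_eq_fintype_card, mul_comm] at h3
  exact_mod_cast h3

theorem finrank_add_finrank_hermPerp (hF : Fintype.card F = p ^ 2) (W : Submodule F (ι → F)) :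
    Module.finrank F W + Module.finrank F (hermPerp p W) = Fintype.card ι := by
  classical
  have h := card_mul_card_hermPerp hF W
  rw [Nat.card_eq_fintype_card, Nat.card_eq_fintype_card, Nat.card_eq_fintype_card,
    Module.card_eq_pow_finrank (K := F) (V := W),
    Module.card_eq_pow_finrank (K := F) (V := hermPerp p W), ← pow_add, Fintype.card_fun] at h
  exact Nat.pow_right_injective Fintype.one_lt_card h

theorem hermPerp_hermPerp (hF : Fintype.card F = p ^ 2) (W : Submodule F (ι → F)) :
    hermPerp p (hermPerp p W) = W := by
  symm
  refine Submodule.eq_of_le_of_finrank_eq (fun x hx y hy => ?_) ?_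
  · rw [hermForm_symm hF y x, hy x hx, zero_pow (Fact.out : p.Prime).ne_zero]
  · have h1 := finrank_add_finrank_hermPerp hF W
    have h2 := finrank_add_finrank_hermPerp hF (hermPerp p W)
    omega

theorem hermPerp_inf (hF : Fintype.card F = p ^ 2) (A B : Submodule F (ι → F)) :
    hermPerp p (A ⊓ B) = hermPerp p A ⊔ hermPerp p B := by
  rw [← hermPerp_hermPerp hF (hermPerp p A ⊔ hermPerp p B), hermPerp_sup,
    hermPerp_hermPerp hF, hermPerp_hermPerp hF]

theorem hermPerp_eq_self (hF : Fintype.card F = p ^ 2) {d : ℕ} (hι : Fintype.card ι = 2 * d)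
    {W : Submodule F (ι → F)}
    (hW : Module.finrank F W = d) (hiso : ∀ x ∈ W, ∀ y ∈ W, hermForm p x y = 0) :
    hermPerp p W = W := by
  symm
  refine Submodule.eq_of_le_of_finrank_eq (fun x hx y hy => hiso x hx y hy) ?_
  have h1 := finrank_add_finrank_hermPerp hF W
  omega

end HermitianForm

section TripleOfGenerators

variable {p : ℕ} {F : Type*} [Field F] {ι : Type*} [Fintype ι]

/-- The linear map `(u, v, w) ↦ u + v + w` on a triple of subspaces. -/
def tripleSum {V : Type*} [AddCommGroup V] [Module F V] (a b c : Submodule F V) :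
    (a × b × c) →ₗ[F] V :=
  a.subtype.coprod (b.subtype.coprod c.subtype)

theorem tripleSum_apply {V : Type*} [AddCommGroup V] [Module F V] {a b c : Submodule F V}
    (z : a × b × c) : tripleSum a b c z = z.1 + (z.2.1 + z.2.2) := rfl

theorem range_tripleSum {V : Type*} [AddCommGroup V] [Module F V] (a b c : Submodule F V) :
    LinearMap.range (tripleSum a b c) = a ⊔ (b ⊔ c) := by
  simp [tripleSum, LinearMap.range_coprod]

/-- The map `(s, t, u) ↦ (s + t, u - s, -t - u)` from the pairwise intersections of a triple of
subspaces to the kernel of `tripleSum`. -/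
def tripleSyzygy {V : Type*} [AddCommGroup V] [Module F V] (a b c : Submodule F V) :
    ((a ⊓ b : Submodule F V) × (a ⊓ c : Submodule F V) × (b ⊓ c : Submodule F V)) →ₗ[F]
      LinearMap.ker (tripleSum a b c) where
  toFun z := ⟨(⟨z.1 + z.2.1, a.add_mem z.1.2.1 z.2.1.2.1⟩,
    ⟨z.2.2 - z.1, b.sub_mem z.2.2.2.1 z.1.2.2⟩,
    ⟨-z.2.1 - z.2.2, c.sub_mem (c.neg_mem z.2.1.2.2) z.2.2.2.2⟩), by
      rw [LinearMap.mem_ker, tripleSum_apply]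
      change (z.1 : V) + (z.2.1 : V) + ((z.2.2 : V) - z.1 + (-(z.2.1 : V) - z.2.2)) = 0
      abel⟩
  map_add' y z := by
    refine Subtype.ext (Prod.ext (Subtype.ext ?_) (Prod.ext (Subtype.ext ?_) (Subtype.ext ?_))) <;>
    · simp
      abel
  map_smul' l z := by
    refine Subtype.ext (Prod.ext (Subtype.ext ?_) (Prod.ext (Subtype.ext ?_) (Subtype.ext ?_))) <;>
    simp [smul_sub]

theorem finrank_ker_tripleSyzygy {V : Type*} [AddCommGroup V] [Module F V]
    (a b c : Submodule F V) :
    Module.finrank F (LinearMap.ker (tripleSyzygy a b c)) =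
      Module.finrank F (a ⊓ b ⊓ c : Submodule F V) := by
  have h1 : a ⊓ b ⊓ c ≤ a ⊓ b := inf_le_left
  have h2 : a ⊓ b ⊓ c ≤ a ⊓ c := inf_le_inf_right c inf_le_left
  have h3 : a ⊓ b ⊓ c ≤ b ⊓ c := inf_le_inf_right c inf_le_right
  let j := (Submodule.inclusion h1).prod ((-Submodule.inclusion h2).prod (Submodule.inclusion h3))
  have hj : LinearMap.ker (tripleSyzygy a b c) = LinearMap.range j := by
    ext ⟨s, t, u⟩
    rw [LinearMap.mem_ker, LinearMap.mem_range]
    constructor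
    · intro hz
      have h4 : (s : V) + t = 0 := congrArg (fun z => (z.1.1 : V)) hz
      have h5 : (u : V) - s = 0 := congrArg (fun z => (z.1.2.1 : V)) hz
      have hts : -(s : V) = t := (eq_neg_of_add_eq_zero_right h4).symm
      have hus : (s : V) = u := (sub_eq_zero.1 h5).symm
      exact ⟨⟨s, s.2, hus ▸ u.2.2⟩,
        Prod.ext (Subtype.ext rfl) (Prod.ext (Subtype.ext hts) (Subtype.ext hus))⟩
    · rintro ⟨x, hx⟩
      have hs : (x : V) = s := congrArg (fun z => (z.1 : V)) hx
      have ht : -(x : V) = t := congrArg (fun z => (z.2.1 : V)) hx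
      have hu : (x : V) = u := congrArg (fun z => (z.2.2 : V)) hx
      refine Subtype.ext (Prod.ext (Subtype.ext ?_) (Prod.ext (Subtype.ext ?_) (Subtype.ext ?_)))
      · change (s : V) + (t : V) = 0
        rw [← hs, ← ht, add_neg_cancel]
      · change (u : V) - (s : V) = 0
        rw [← hs, ← hu, sub_self]
      · change -(t : V) - (u : V) = 0
        rw [← ht, ← hu, neg_neg, sub_self]
  rw [hj]
  refine LinearMap.finrank_range_of_inj fun x y h => Subtype.ext ?_
  exact congrArg (fun z => (z.1 : V)) h

variable [Fact p.Prime] [CharP F p] [Fintype F]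

theorem finrank_ker_tripleSum (hF : Fintype.card F = p ^ 2) {d : ℕ}
    (hι : Fintype.card ι = 2 * d) {a b c : Submodule F (ι → F)} (ha : hermPerp p a = a)
    (hb : hermPerp p b = b) (hc : hermPerp p c = c) :
    Module.finrank F (LinearMap.ker (tripleSum a b c)) =
      d + Module.finrank F (a ⊓ b ⊓ c : Submodule F (ι → F)) := by
  have h1 := LinearMap.finrank_range_add_finrank_ker (tripleSum a b c)
  have h2 := finrank_add_finrank_hermPerp hF (a ⊓ b ⊓ c)
  rw [hermPerp_inf hF, hermPerp_inf hF, ha, hb, hc, hι] at h2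
  rw [range_tripleSum, ← sup_assoc, Module.finrank_prod, Module.finrank_prod] at h1
  have h3 := finrank_add_finrank_hermPerp hF a
  have h4 := finrank_add_finrank_hermPerp hF b
  have h5 := finrank_add_finrank_hermPerp hF c
  rw [ha, hι] at h3
  rw [hb, hι] at h4
  rw [hc, hι] at h5
  omega

theorem mem_range_tripleSyzygy_iff (hF : Fintype.card F = p ^ 2) {a b c : Submodule F (ι → F)}
    (ha : hermPerp p a = a) (hb : hermPerp p b = b) (hc : hermPerp p c = c)
    (z : LinearMap.ker (tripleSum a b c)) :
    z ∈ LinearMap.range (tripleSyzygy a b c) ↔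
      ∀ y : LinearMap.ker (tripleSum a b c), hermForm p (z.1.1 : ι → F) y.1.2.1 = 0 := by
  constructor
  · rintro ⟨⟨s, t, u⟩, rfl⟩ y
    obtain ⟨⟨y₁, y₂, y₃⟩, hy⟩ := y
    rw [LinearMap.mem_ker, tripleSum_apply] at hy
    change hermForm p ((s : ι → F) + (t : ι → F)) (y₂ : ι → F) = 0
    have h1 : (y₂ : ι → F) = -(y₁ : ι → F) - y₃ := by
      rw [eq_sub_iff_add_eq, eq_neg_iff_add_eq_zero, add_comm]
      exact hy
    have hs : hermForm p (s : ι → F) y₂ = 0 := (hb.ge s.2.2) _ y₂.2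
    have ht : hermForm p (t : ι → F) y₂ = 0 := by
      rw [h1, hermForm_sub_right, hermForm_neg_right, (ha.ge t.2.1) _ y₁.2,
        (hc.ge t.2.2) _ y₃.2, neg_zero, sub_zero]
    rw [hermForm_add_left, hs, ht, add_zero]
  · intro h
    obtain ⟨⟨z₁, z₂, z₃⟩, hz⟩ := z
    have hz' := hz
    rw [LinearMap.mem_ker, tripleSum_apply] at hz'
    have hmem : (z₁ : ι → F) ∈ b ⊔ (a ⊓ c) := by
      have hperp : b ⊔ (a ⊓ c) = hermPerp p (b ⊓ (a ⊔ c)) := by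
        rw [hermPerp_inf hF, hermPerp_sup, ha, hb, hc]
      rw [hperp]
      rintro y ⟨hyb, hyac⟩
      obtain ⟨u, hu, w, hw, rfl⟩ := Submodule.mem_sup.1 hyac
      refine h ⟨(⟨-u, a.neg_mem hu⟩, ⟨u + w, hyb⟩, ⟨-w, c.neg_mem hw⟩), ?_⟩
      rw [LinearMap.mem_ker, tripleSum_apply]
      simp
    obtain ⟨s, hs, t, ht, hst⟩ := Submodule.mem_sup.1 hmem
    have hsa : s ∈ a := by
      rw [eq_sub_of_add_eq hst]
      exact a.sub_mem z₁.2 ht.1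
    have huc : (z₂ : ι → F) + s ∈ c := by
      have : (z₂ : ι → F) + s = -t - z₃ := by
        rw [eq_sub_iff_add_eq, eq_neg_iff_add_eq_zero, ← hz', ← hst]
        abel
      rw [this]
      exact c.sub_mem (c.neg_mem ht.2) z₃.2
    refine ⟨(⟨s, hsa, hs⟩, ⟨t, ht⟩, ⟨z₂ + s, b.add_mem z₂.2 hs, huc⟩), ?_⟩
    refine Subtype.ext (Prod.ext (Subtype.ext ?_) (Prod.ext (Subtype.ext ?_) (Subtype.ext ?_)))
    · exact hst
    · simp [tripleSyzygy]
    · change -t - ((z₂ : ι → F) + s) = z₃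
      rw [← sub_eq_zero, ← neg_eq_zero, ← hz', ← hst]
      abel

/-- The Gauss sum attached to a triple of generators of a Hermitian polar space. -/
theorem sum_addChar_tripleSum (hF : Fintype.card F = p ^ 2) {ψ : AddChar F ℂ} {x₀ : F}
    (hψ : ψ (x₀ - x₀ ^ p) ≠ 1) {d : ℕ} (hι : Fintype.card ι = 2 * d)
    {a b c : Submodule F (ι → F)} [Fintype (LinearMap.ker (tripleSum a b c))]
    (ha : hermPerp p a = a) (hb : hermPerp p b = b) (hc : hermPerp p c = c) :
    ∑ z : LinearMap.ker (tripleSum a b c), ψ (hermForm p (z.1.1 : ι → F) z.1.2.1) =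
      (-p : ℂ) ^ (d + Module.finrank F (a ⊓ b : Submodule F (ι → F)) +
        Module.finrank F (a ⊓ c : Submodule F (ι → F)) +
        Module.finrank F (b ⊓ c : Submodule F (ι → F))) := by
  have h := sum_addChar_sesq (K := LinearMap.ker (tripleSum a b c))
    (B := fun z y => hermForm p (z.1.1 : ι → F) y.1.2.1) hF hψ
    (fun x y z => hermForm_add_left _ _ _) (fun l x y => hermForm_smul_left _ _ _) ?_
    (LinearMap.range (tripleSyzygy a b c)) (mem_range_tripleSyzygy_iff hF ha hb hc)
  · rw [h]
    congr 1
    have h1 := LinearMap.finrank_range_add_finrank_ker (K := F)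
      (V₂ := LinearMap.ker (tripleSum a b c)) (tripleSyzygy a b c)
    rw [finrank_ker_tripleSyzygy, Module.finrank_prod, Module.finrank_prod] at h1
    rw [finrank_ker_tripleSum hF hι ha hb hc]
    omega
  · rintro ⟨⟨x₁, x₂, x₃⟩, hx⟩ ⟨⟨y₁, y₂, y₃⟩, hy⟩
    rw [LinearMap.mem_ker, tripleSum_apply] at hx hy
    change hermForm p (y₁ : ι → F) x₂ = -(hermForm p (x₁ : ι → F) y₂) ^ p
    have h1 : hermForm p (y₁ : ι → F) x₁ = 0 := (ha.ge y₁.2) _ x₁.2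
    have h2 : hermForm p (y₂ : ι → F) x₂ = 0 := (hb.ge y₂.2) _ x₂.2
    have h3 : hermForm p (y₃ : ι → F) x₃ = 0 := (hc.ge y₃.2) _ x₃.2
    have hx' : (x₃ : ι → F) = -((x₁ : ι → F) + x₂) :=
      eq_neg_of_add_eq_zero_right (by rw [add_assoc]; exact hx)
    have hy' : (y₃ : ι → F) = -((y₁ : ι → F) + y₂) :=
      eq_neg_of_add_eq_zero_right (by rw [add_assoc]; exact hy)
    rw [hx', hy', hermForm_neg_left, hermForm_neg_right, neg_neg, hermForm_add_left,
      hermForm_add_right, hermForm_add_right, h1, h2, zero_add, add_zero] at h3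
    rw [eq_neg_of_add_eq_zero_left h3, hermForm_symm hF]

end TripleOfGenerators

section WeilVector

variable {p : ℕ} {F : Type*} [Field F] [Fintype F] {ι : Type*} [Fintype ι] [DecidableEq ι]

open Classical in
/-- The function on `ι → F` that the Weil representation attaches to the subspace `a` and the
polarising subspace `c`. -/
noncomputable def weilVector (p : ℕ) (ψ : AddChar F ℂ) (a c : Submodule F (ι → F))
    (x : ι → F) : ℂ :=
  ∑ v ∈ Finset.univ.filter fun v : ι → F => v ∈ a ∧ v - x ∈ c, ψ (hermForm p x v)

theorem weilVector_smul (ψ : AddChar F ℂ) (a c : Submodule F (ι → F)) (x : ι → F) {l : F}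
    (hl : l ^ (p + 1) = 1) : weilVector p ψ a c (l • x) = weilVector p ψ a c x := by
  have hl0 : l ≠ 0 := by
    rintro rfl
    simp at hl
  unfold weilVector
  symm
  refine Finset.sum_nbij' (fun v => l • v) (fun v => l⁻¹ • v) ?_ ?_ ?_ ?_ ?_
  · intro v hv
    simp only [Finset.mem_filter, Finset.mem_univ, true_and] at hv ⊢
    rw [← smul_sub]
    exact ⟨a.smul_mem l hv.1, c.smul_mem l hv.2⟩
  · intro v hv
    simp only [Finset.mem_filter, Finset.mem_univ, true_and] at hv ⊢
    refine ⟨a.smul_mem _ hv.1, ?_⟩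
    have := c.smul_mem l⁻¹ hv.2
    rwa [smul_sub, inv_smul_smul₀ hl0] at this
  · intro v _
    exact inv_smul_smul₀ hl0 v
  · intro v _
    exact smul_inv_smul₀ hl0 v
  · intro v _
    rw [hermForm_smul_left, hermForm_smul_right, ← mul_assoc, ← pow_succ', hl, one_mul]

theorem sum_weilVector_mul_weilVector [Fact p.Prime] [CharP F p] (hF : Fintype.card F = p ^ 2)
    {ψ : AddChar F ℂ} {x₀ : F} (hψ : ψ (x₀ - x₀ ^ p) ≠ 1) {d : ℕ} (hι : Fintype.card ι = 2 * d)
    {a b c c' : Submodule F (ι → F)} [Fintype c'] (ha : hermPerp p a = a)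
    (hb : hermPerp p b = b) (hc : hermPerp p c = c) (hcc' : IsCompl c c') :
    ∑ x : c', weilVector p ψ a c x * weilVector p ψ⁻¹ b c x =
      (-p : ℂ) ^ (d + Module.finrank F (a ⊓ b : Submodule F (ι → F)) +
        Module.finrank F (a ⊓ c : Submodule F (ι → F)) +
        Module.finrank F (b ⊓ c : Submodule F (ι → F))) := by
  classical
  rw [← sum_addChar_tripleSum hF hψ hι ha hb hc]
  simp only [weilVector, Finset.sum_mul_sum, ← Finset.sum_product']
  rw [Finset.sum_sigma']
  refine Finset.sum_bij (fun z hz => ⟨(⟨z.2.1, ?_⟩, ⟨-z.2.2, ?_⟩, ⟨z.2.2 - z.2.1, ?_⟩), ?_⟩)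
    ?_ ?_ ?_ ?_
  · simp only [Finset.mem_sigma, Finset.mem_product, Finset.mem_filter, Finset.mem_univ,
      true_and] at hz
    exact hz.1.1
  · simp only [Finset.mem_sigma, Finset.mem_product, Finset.mem_filter, Finset.mem_univ,
      true_and] at hz
    exact b.neg_mem hz.2.1
  · simp only [Finset.mem_sigma, Finset.mem_product, Finset.mem_filter, Finset.mem_univ,
      true_and] at hz
    have := c.sub_mem hz.2.2 hz.1.2
    rwa [sub_sub_sub_cancel_right] at this
  · rw [LinearMap.mem_ker, tripleSum_apply]
    change z.2.1 + (-z.2.2 + (z.2.2 - z.2.1)) = 0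
    abel
  · exact fun _ _ => Finset.mem_univ _
  · rintro ⟨x, v, v'⟩ h ⟨y, w, w'⟩ h' heq
    simp only [Finset.mem_sigma, Finset.mem_product, Finset.mem_filter, Finset.mem_univ,
      true_and] at h h'
    have h1 : v = w := congrArg (fun z => (z.1.1 : ι → F)) heq
    have h2 : -v' = -w' := congrArg (fun z => (z.1.2.1 : ι → F)) heq
    have h2' : v' = w' := neg_injective h2
    subst h1 h2'
    have hxy : (x : ι → F) - y ∈ c ⊓ c' := by
      refine ⟨?_, c'.sub_mem x.2 y.2⟩
      have := c.sub_mem h'.1.2 h.1.2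
      rwa [sub_sub_sub_cancel_left] at this
    rw [hcc'.inf_eq_bot, Submodule.mem_bot, sub_eq_zero] at hxy
    rw [Subtype.ext hxy]
  · rintro ⟨⟨v, u, w⟩, hz⟩ _
    have hz' := hz
    rw [LinearMap.mem_ker, tripleSum_apply] at hz'
    have hv : (v : ι → F) ∈ c ⊔ c' := hcc'.sup_eq_top ▸ Submodule.mem_top
    obtain ⟨s, hs, x, hx, hsx⟩ := Submodule.mem_sup.1 hv
    have hw : -(u : ι → F) - v = w := by
      rw [sub_eq_iff_eq_add, neg_eq_iff_add_eq_zero, ← hz']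
      abel
    refine ⟨⟨⟨x, hx⟩, v, -u⟩, ?_, ?_⟩
    · simp only [Finset.mem_sigma, Finset.mem_product, Finset.mem_filter, Finset.mem_univ,
        true_and]
      have hvx : (v : ι → F) - x ∈ c := by rwa [← hsx, add_sub_cancel_right]
      refine ⟨⟨v.2, hvx⟩, b.neg_mem u.2, ?_⟩
      have : -(u : ι → F) - x = w + (v - x) := by
        rw [← hw]
        abel
      rw [this]
      exact c.add_mem w.2 hvx
    · refine Subtype.ext (Prod.ext rfl (Prod.ext (Subtype.ext (neg_neg _)) (Subtype.ext hw)))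
  · rintro ⟨x, v, v'⟩ h
    simp only [Finset.mem_sigma, Finset.mem_product, Finset.mem_filter, Finset.mem_univ,
      true_and] at h
    change ψ (hermForm p (x : ι → F) v) * ψ⁻¹ (hermForm p (x : ι → F) v') = ψ (hermForm p v (-v'))
    rw [AddChar.inv_apply, ← AddChar.map_add_eq_mul]
    congr 1
    have h1 : hermForm p v v = 0 := (ha.ge h.1.1) _ h.1.1
    have hw : v' - v ∈ c := by
      have := c.sub_mem h.2.2 h.1.2
      rwa [sub_sub_sub_cancel_right] at this
    have h2 : hermForm p (v - (x : ι → F)) (v' - v) = 0 := (hc.ge h.1.2) _ hw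
    rw [sub_eq_add_neg v, hermForm_add_left, hermForm_neg_left, hermForm_sub_right,
      hermForm_sub_right, h1] at h2
    rw [hermForm_neg_right]
    linear_combination h2

end WeilVector

section RankReduction

theorem exists_linearIndependent_rows_of_rank {m n k : Type*} [Fintype m] [Fintype n] [Field k]
    (A : Matrix m n k) {r : ℕ} (hr : A.rank = r) :
    ∃ f : Fin r → m, LinearIndependent k (A.submatrix f id).row := by
  subst hr
  rw [A.rank_eq_finrank_span_row]
  obtain ⟨f, hf, -, hli⟩ := Submodule.exists_fun_fin_finrank_span_eq k (Set.range A.row)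
  choose g hg using hf
  refine ⟨g, ?_⟩
  have : (A.submatrix g id).row = f := funext hg
  rwa [this]

theorem exists_submatrix_isUnit_of_rank {m n k : Type*} [Fintype m] [Fintype n] [Field k]
    (A : Matrix m n k) :
    ∃ (f : Fin A.rank → m) (g : Fin A.rank → n), IsUnit (A.submatrix f g) := by
  obtain ⟨f, hf⟩ := exists_linearIndependent_rows_of_rank A rfl
  have hr : (A.submatrix f id).transpose.rank = A.rank := by
    rw [Matrix.rank_transpose, LinearIndependent.rank_matrix hf, Fintype.card_fin]
  obtain ⟨g, hg⟩ := exists_linearIndependent_rows_of_rank _ hr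
  refine ⟨f, g, ?_⟩
  rw [Matrix.linearIndependent_rows_iff_isUnit] at hg
  rw [← Matrix.isUnit_transpose]
  exact hg

/-- An integer matrix that factors over `L` through dimension `#n` has rank at most `#n` over
every field. -/
theorem rank_map_intCast_le_of_eq_mul {m m' n L k : Type*} [Fintype m] [Fintype m'] [Fintype n]
    [Field L] [CharZero L] [Field k] (Z : Matrix m m' ℤ) (X : Matrix m n L) (Y : Matrix n m' L)
    (h : Z.map (Int.cast : ℤ → L) = X * Y) :
    (Z.map (Int.cast : ℤ → k)).rank ≤ Fintype.card n := by
  obtain ⟨f, g, hu⟩ := exists_submatrix_isUnit_of_rank (Z.map (Int.cast : ℤ → k))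
  have hdet : (Z.submatrix f g).det ≠ 0 := by
    intro h0
    rw [Matrix.isUnit_iff_isUnit_det] at hu
    have : ((Z.map (Int.cast : ℤ → k)).submatrix f g).det = ((Z.submatrix f g).det : k) :=
      ((Int.castRingHom k).map_det _).symm
    rw [this, h0, Int.cast_zero] at hu
    exact not_isUnit_zero hu
  have hunit : IsUnit ((Z.submatrix f g).map (Int.cast : ℤ → L)) := by
    rw [Matrix.isUnit_iff_isUnit_det]
    have : ((Z.submatrix f g).map (Int.cast : ℤ → L)).det = ((Z.submatrix f g).det : L) :=
      ((Int.castRingHom L).map_det _).symm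
    rw [this]
    exact (Int.cast_ne_zero.2 hdet).isUnit
  have hfac : (Z.submatrix f g).map (Int.cast : ℤ → L) = X.submatrix f id * Y.submatrix id g := by
    rw [← Matrix.submatrix_map, h]
    rfl
  have hrank := Matrix.rank_of_isUnit _ hunit
  rw [Fintype.card_fin, hfac] at hrank
  rw [← hrank]
  exact (Matrix.rank_mul_le_left _ _).trans (Matrix.rank_le_card_width _)

theorem sum_mul_eq_sum_orbits {N X R : Type*} [Group N] [MulAction N X] [Fintype X]
    [CommSemiring R] [Fintype (MulAction.orbitRel.Quotient N X)]
    [DecidableEq (MulAction.orbitRel.Quotient N X)] {f g : X → R}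
    (hf : ∀ (l : N) x, f (l • x) = f x) (hg : ∀ (l : N) x, g (l • x) = g x) :
    ∑ x, f x * g x = ∑ o : MulAction.orbitRel.Quotient N X, f o.out *
      ((Finset.univ.filter fun x : X =>
        (Quotient.mk'' x : MulAction.orbitRel.Quotient N X) = o).card * g o.out) := by
  rw [← Finset.sum_fiberwise (g := fun x : X =>
    (Quotient.mk'' x : MulAction.orbitRel.Quotient N X))]
  refine Finset.sum_congr rfl fun o _ => ?_
  rw [Finset.sum_congr rfl (g := fun _ => f o.out * g o.out), Finset.sum_const, nsmul_eq_mul]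
  · ring
  · intro x hx
    rw [Finset.mem_filter] at hx
    have hox : (Quotient.mk'' x : MulAction.orbitRel.Quotient N X) = Quotient.mk'' o.out := by
      rw [hx.2]
      exact (Quotient.out_eq' o).symm
    obtain ⟨l, hl⟩ := Quotient.eq''.1 hox
    have hl' : l • o.out = x := hl
    rw [← hl', hf, hg]

end RankReduction

section Generators

variable {p : ℕ} {F : Type*} [Field F]

/-- The image of `x ↦ (x, ε x)` in coordinates indexed by `ι ≃ κ ⊕ κ`. -/
def graphMap {ι κ : Type*} (E : ι ≃ κ ⊕ κ) (ε : F) : (κ → F) →ₗ[F] (ι → F) where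
  toFun x i := Sum.elim x (ε • x) (E i)
  map_add' x y := by
    ext i
    cases h : E i <;> simp [h]
  map_smul' l x := by
    ext i
    cases h : E i <;> simp [h, mul_left_comm]

theorem graphMap_injective {ι κ : Type*} (E : ι ≃ κ ⊕ κ) (ε : F) :
    Function.Injective (graphMap E ε) := by
  intro x y h
  ext i
  simpa [graphMap] using congrFun h (E.symm (Sum.inl i))

theorem hermForm_graphMap {ι κ : Type*} [Fintype ι] [Fintype κ] (E : ι ≃ κ ⊕ κ) (ε : F)
    (x y : κ → F) :
    hermForm p (graphMap E ε x) (graphMap E ε y) = (1 + ε ^ (p + 1)) * hermForm p x y := by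
  unfold hermForm
  rw [← Equiv.sum_comp E.symm, Fintype.sum_sum_type, add_mul, one_mul, Finset.mul_sum]
  congr 1
  · simp [graphMap]
  · refine Finset.sum_congr rfl fun i _ => ?_
    simp only [graphMap, LinearMap.coe_mk, AddHom.coe_mk, Equiv.apply_symm_apply, Sum.elim_inr,
      Pi.smul_apply, smul_eq_mul]
    ring

variable [Fintype F]

/-- The Hermitian polar space has a pair of opposite generators. -/
theorem exists_isCompl_hermPerp_eq_self [Fact p.Prime] [CharP F p]
    (hF : Fintype.card F = p ^ 2) {ι : Type*} [Fintype ι] {d : ℕ}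
    (hι : Fintype.card ι = 2 * d) :
    ∃ c c' : Submodule F (ι → F), hermPerp p c = c ∧ IsCompl c c' ∧ Module.finrank F c' = d := by
  classical
  have hp : p.Prime := Fact.out
  have hneg : (-1 : Fˣ) ^ p = -1 := by
    ext
    simpa using neg_one_pow_char F p
  have hcard := card_normPow_fiber hF hneg
  have hlt : 1 < (Finset.univ.filter fun l : Fˣ => l ^ (p + 1) = -1).card := by
    rw [hcard]
    exact Nat.succ_lt_succ hp.pos
  obtain ⟨ε, hε, ε', hε', hne⟩ := Finset.one_lt_card.1 hlt
  simp only [Finset.mem_filter, Finset.mem_univ, true_and] at hε hε'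
  have E : ι ≃ Fin d ⊕ Fin d := Fintype.equivOfCardEq (by simp [hι, two_mul])
  have hfin : ∀ l : F, Module.finrank F (LinearMap.range (graphMap E l)) = d := fun l => by
    rw [LinearMap.finrank_range_of_inj (graphMap_injective E l), Module.finrank_fin_fun]
  have hε1 : (ε : F) ^ (p + 1) = -1 := by
    simpa using congrArg Units.val hε
  have hdisj : Disjoint (LinearMap.range (graphMap E (ε : F)))
      (LinearMap.range (graphMap E (ε' : F))) := by
    rw [disjoint_iff, Submodule.eq_bot_iff]
    rintro _ ⟨⟨x, rfl⟩, ⟨y, hy⟩⟩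
    have h1 : ∀ i, y i = x i := fun i => by
      simpa [graphMap] using congrFun hy (E.symm (Sum.inl i))
    have h2 : ∀ i, (ε' : F) * y i = ε * x i := fun i => by
      simpa [graphMap] using congrFun hy (E.symm (Sum.inr i))
    have h3 : x = 0 := by
      ext i
      have h4 : ((ε' : F) - ε) * x i = 0 := by
        have := h2 i
        rw [h1] at this
        linear_combination this
      refine (mul_eq_zero.1 h4).resolve_left (sub_ne_zero.2 fun h => hne (Units.ext h.symm))
    rw [h3, map_zero]
  refine ⟨LinearMap.range (graphMap E (ε : F)), LinearMap.range (graphMap E (ε' : F)), ?_, ?_,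
    hfin _⟩
  · refine hermPerp_eq_self hF hι (hfin _) ?_
    rintro _ ⟨x, rfl⟩ _ ⟨y, rfl⟩
    rw [hermForm_graphMap, hε1, add_neg_cancel, zero_mul]
  · rw [Submodule.isCompl_iff_disjoint _ _ ?_]
    · exact hdisj
    · rw [hfin, hfin, Module.finrank_fintype_fun_eq_card, hι, two_mul]

theorem card_orbits_normPow [Fact p.Prime] (hF : Fintype.card F = p ^ 2) {M : Type*}
    [AddCommGroup M] [Module F M] [Fintype M]
    [Fintype (MulAction.orbitRel.Quotient (powMonoidHom (p + 1) : Fˣ →* Fˣ).ker M)] :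
    Fintype.card (MulAction.orbitRel.Quotient (powMonoidHom (p + 1) : Fˣ →* Fˣ).ker M) * (p + 1) =
      (p ^ 2) ^ Module.finrank F M + p := by
  classical
  have h := MulAction.sum_card_fixedBy_eq_card_orbits_mul_card_group
    (powMonoidHom (p + 1) : Fˣ →* Fˣ).ker M
  have hcard := card_ker_normPow hF
  rw [Nat.card_eq_fintype_card] at hcard
  rw [hcard] at h
  have hfix : ∀ l ∈ Finset.univ.erase (1 : (powMonoidHom (p + 1) : Fˣ →* Fˣ).ker),
      Fintype.card (MulAction.fixedBy M l) = 1 := by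
    intro l hl
    rw [Fintype.card_eq_one_iff]
    refine ⟨⟨0, smul_zero _⟩, fun ⟨x, hx⟩ => Subtype.ext ?_⟩
    by_contra hx0
    have h1 : ((l : Fˣ) : F) • x = (1 : F) • x := by
      rw [one_smul]
      exact hx
    exact Finset.ne_of_mem_erase hl (Subtype.ext (Units.ext (smul_left_injective F hx0 h1)))
  have hone : Fintype.card (MulAction.fixedBy M (1 : (powMonoidHom (p + 1) : Fˣ →* Fˣ).ker)) =
      (p ^ 2) ^ Module.finrank F M := by
    rw [← hF, ← Module.card_eq_pow_finrank]
    exact Fintype.card_congr (Equiv.subtypeUnivEquiv fun x => one_smul _ x)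
  rw [← Finset.add_sum_erase _ _ (Finset.mem_univ 1), Finset.sum_congr rfl hfix, hone,
    Finset.sum_const, Finset.card_erase_of_mem (Finset.mem_univ _), Finset.card_univ, hcard] at h
  rw [← h]
  simp

end Generators

theorem eq_sub_mul_div_of_mul_succ_eq {p d m : ℕ} (hp : 0 < p) (hd : 1 ≤ d)
    (h : m * (p + 1) = (p ^ 2) ^ d + p) :
    m = p ^ (2 * d - 1) - p * ((p ^ (2 * d - 2) - 1) / (p + 1)) := by
  obtain ⟨e, rfl⟩ : ∃ e, d = e + 1 := ⟨d - 1, by omega⟩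
  have hdvd : p + 1 ∣ (p ^ 2) ^ e - 1 := by
    have h1 : p + 1 ∣ p ^ 2 - 1 := ⟨p - 1, by simpa using Nat.sq_sub_sq p 1⟩
    simpa using h1.trans (Nat.sub_dvd_pow_sub_pow (p ^ 2) 1 e)
  obtain ⟨k, hk⟩ := hdvd
  have hpow : (p ^ 2) ^ e = (p + 1) * k + 1 := by
    have := Nat.pos_of_ne_zero (pow_ne_zero e (pow_ne_zero 2 hp.ne'))
    omega
  have hm : m = p ^ 2 * k + p := by
    refine Nat.eq_of_mul_eq_mul_right (Nat.succ_pos p) ?_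
    rw [Nat.succ_eq_add_one, h, pow_succ, hpow]
    ring
  have h1 : 2 * (e + 1) - 1 = 2 * e + 1 := by omega
  have h2 : 2 * (e + 1) - 2 = 2 * e := by omega
  rw [h1, h2, pow_succ, pow_mul, hk, hpow, Nat.mul_div_cancel_left _ (Nat.succ_pos p), hm]
  refine (Nat.sub_eq_of_eq_add ?_).symm
  ring

/-- Lemma 4(b): for even `d ≥ 2`, the `p`-rank of the oppositeness matrix of generators of
`H(2d-1, p²)` is at most `p^(2d-1) - p·(p^(2d-2) - 1)/(p + 1)`. -/
theorem prank_oppositeness_hermitian_le (p d : ℕ) (hp : p.Prime) (hd : 2 ≤ d)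
    (hdeven : Even d)
    (F : Type) [Field F] [Fintype F] (hF : Fintype.card F = p ^ 2)
    (G : Type) [Fintype G]
    (e : G ≃ {W : Submodule F (Fin (2 * d) → F) // Module.finrank F W = d ∧
      ∀ x ∈ W, ∀ y ∈ W, ∑ i, x i * y i ^ p = 0})
    (A : Matrix G G (ZMod p))
    (hA1 : ∀ a b : G, (e a).1 ⊓ (e b).1 = ⊥ → A a b = 1)
    (hA0 : ∀ a b : G, (e a).1 ⊓ (e b).1 ≠ ⊥ → A a b = 0) :
    A.rank ≤ p ^ (2 * d - 1) - p * ((p ^ (2 * d - 2) - 1) / (p + 1)) := by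
  classical
  have : Fact p.Prime := ⟨hp⟩
  have : CharP F p := charP_of_card_eq_prime_pow hF
  have hι : Fintype.card (Fin (2 * d)) = 2 * d := Fintype.card_fin _
  have hperp : ∀ a : G, hermPerp p (e a).1 = (e a).1 := fun a =>
    hermPerp_eq_self hF hι (e a).2.1 (e a).2.2
  obtain ⟨ψ, x₀, hψ⟩ := exists_addChar_sub_pow_ne_one hF
  obtain ⟨c, c', hc, hcc', hc'⟩ := exists_isCompl_hermPerp_eq_self (p := p) hF hι
  let N := (powMonoidHom (p + 1) : Fˣ →* Fˣ).ker
  let Ω := MulAction.orbitRel.Quotient N c'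
  have hΩ : Fintype.card Ω = p ^ (2 * d - 1) - p * ((p ^ (2 * d - 2) - 1) / (p + 1)) := by
    refine eq_sub_mul_div_of_mul_succ_eq hp.pos (by omega) ?_
    have h := card_orbits_normPow (M := c') hF
    rwa [hc'] at h
  have hinv : ∀ (ψ : AddChar F ℂ) (a : G) (l : N) (x : c'),
      weilVector p ψ (e a).1 c ((l • x : c') : Fin (2 * d) → F) =
        weilVector p ψ (e a).1 c x := by
    intro ψ a l x
    have hl : (l : Fˣ) ^ (p + 1) = 1 := l.2
    refine weilVector_smul ψ _ c x (l := ((l : Fˣ) : F)) ?_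
    rw [← Units.val_pow_eq_pow_val, hl, Units.val_one]
  let Z : Matrix G G ℤ := Matrix.of fun a b =>
    (-p : ℤ) ^ Module.finrank F ((e a).1 ⊓ (e b).1 : Submodule F (Fin (2 * d) → F))
  let i : G → ℕ := fun a => Module.finrank F ((e a).1 ⊓ c : Submodule F (Fin (2 * d) → F))
  have hAZ : A = Z.map (Int.cast : ℤ → ZMod p) := by
    ext a b
    by_cases h : (e a).1 ⊓ (e b).1 = ⊥
    · have h0 : Module.finrank F ((e a).1 ⊓ (e b).1 : Submodule F (Fin (2 * d) → F)) = 0 := by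
        rw [h]
        exact finrank_bot F _
      simp [hA1 a b h, Z, h0]
    · have hpos : Module.finrank F ((e a).1 ⊓ (e b).1 : Submodule F (Fin (2 * d) → F)) ≠ 0 :=
        fun h0 => h (Submodule.finrank_eq_zero.1 h0)
      simp [hA0 a b h, Z, hpos]
  let X : Matrix G Ω ℂ := Matrix.of fun a o =>
    ((-p : ℂ) ^ (d + i a))⁻¹ * weilVector p ψ (e a).1 c (o.out : c')
  let Y : Matrix Ω G ℂ := Matrix.of fun o b =>
    ((Finset.univ.filter fun x : c' => (Quotient.mk'' x : Ω) = o).card *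
      weilVector p ψ⁻¹ (e b).1 c (o.out : c')) * ((-p : ℂ) ^ i b)⁻¹
  rw [hAZ, ← hΩ]
  refine rank_map_intCast_le_of_eq_mul Z X Y ?_
  ext a b
  have hsum := sum_weilVector_mul_weilVector hF hψ hι (hperp a) (hperp b) hc hcc'
  rw [sum_mul_eq_sum_orbits (N := N) (hinv ψ a) (hinv ψ⁻¹ b)] at hsum
  have hXY : (X * Y) a b = ((-p : ℂ) ^ (d + i a))⁻¹ * ((-p : ℂ) ^ i b)⁻¹ *
      (-p : ℂ) ^ (d + Module.finrank F ((e a).1 ⊓ (e b).1 : Submodule F (Fin (2 * d) → F)) +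
        i a + i b) := by
    rw [← hsum, Matrix.mul_apply, Finset.mul_sum]
    refine Finset.sum_congr rfl fun o _ => ?_
    simp only [X, Y, Matrix.of_apply]
    ring
  rw [hXY]
  have hp0 : (-p : ℂ) ≠ 0 := neg_ne_zero.2 (Nat.cast_ne_zero.2 hp.ne_zero)
  simp only [Z, Matrix.map_apply, Matrix.of_apply, Int.cast_pow, Int.cast_neg, Int.cast_natCast]
  rw [← mul_inv, ← pow_add, eq_inv_mul_iff_mul_eq₀ (pow_ne_zero _ hp0), ← pow_add]
  congr 1
  ring
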